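/- The problem INJECTIVE for primitive recursive functions is Π1-complete, in the following uniform sense: (i) for every primitive recursive family F, the set {n : ℕ | F n : ℕ → ℕ is injective} is Π1; and (ii) there exists a primitive recursive family F such that the set {n : ℕ | F n is injective} is Π1-complete, i.e. every Π1 subset of ℕ many-one reduces to it. -/

import Mathlib

def Pi1 (P : ℕ → Prop) : Prop := REPred fun n => ¬ P n

def Pi1Complete (Q : ℕ → Prop) : Prop :=
  Pi1 Q ∧ ∀ P : ℕ → Prop, Pi1 P → ManyOneReducible P Q

/-- The projection of a primitive recursive relation is recursively enumerable. -/
theorem REPred.of_primrec_exists {p : ℕ → ℕ → Bool} (hp : Primrec₂ p) :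
    REPred fun n => ∃ k, p n k = true := by
  have h : Partrec fun n => Nat.rfind fun k => Part.some (p n k) :=
    Partrec.rfind hp.to_comp.partrec₂
  refine h.dom_re.of_eq fun n => ?_
  refine Nat.rfind_dom.trans (exists_congr fun k => ?_)
  exact ⟨fun hk => (Part.mem_some_iff.1 hk.1).symm,
    fun hk => ⟨Part.mem_some_iff.2 hk.symm, fun _ => trivial⟩⟩

/-- Non-injectivity is witnessed by a colliding pair. -/
theorem pi1_injective {F : ℕ → ℕ → ℕ} (hF : Primrec₂ F) :
    Pi1 fun n => Function.Injective (F n) := by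
  have hl : Primrec fun q : ℕ × ℕ => q.2.unpair.1 :=
    Primrec.fst.comp (Primrec.unpair.comp Primrec.snd)
  have hr : Primrec fun q : ℕ × ℕ => q.2.unpair.2 :=
    Primrec.snd.comp (Primrec.unpair.comp Primrec.snd)
  have hp : Primrec₂ fun n k : ℕ =>
      (F n k.unpair.1 == F n k.unpair.2) && !(k.unpair.1 == k.unpair.2) :=
    Primrec.and.comp
      (Primrec.beq.comp (hF.comp Primrec.fst hl) (hF.comp Primrec.fst hr))
      (Primrec.not.comp (Primrec.beq.comp hl hr))
  refine (REPred.of_primrec_exists hp).of_eq fun n => ?_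
  simp only [Function.Injective, Bool.and_eq_true, beq_iff_eq, Bool.not_eq_true',
    beq_eq_false_iff_ne, not_forall]
  constructor
  · rintro ⟨k, h, hne⟩
    exact ⟨_, _, h, hne⟩
  · rintro ⟨x, y, h, hne⟩
    exact ⟨Nat.pair x y, by simpa using h, by simpa using hne⟩

/-- A recursively enumerable predicate on `ℕ` is the domain of a partial recursive code. -/
theorem REPred.exists_code {p : ℕ → Prop} (hp : REPred p) :
    ∃ c : Nat.Partrec.Code, ∀ n, (c.eval n).Dom ↔ p n := by
  obtain ⟨c, hc⟩ := Nat.Partrec.Code.exists_code.1 hp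
  refine ⟨c, fun n => ?_⟩
  rw [hc]
  simp [Part.bind_some, Part.assert]

/-- The bounded evaluation, with bound `k`, of the code and input paired in `e`. -/
def boundedEval (e k : ℕ) : Option ℕ :=
  Nat.Partrec.Code.evaln k (Denumerable.ofNat Nat.Partrec.Code e.unpair.1) e.unpair.2

theorem primrec₂_boundedEval : Primrec₂ boundedEval :=
  have hu : Primrec fun q : ℕ × ℕ => q.1.unpair := Primrec.unpair.comp Primrec.fst
  Nat.Partrec.Code.primrec_evaln.comp <|
    Primrec.pair
      (Primrec.pair Primrec.snd ((Primrec.ofNat Nat.Partrec.Code).comp (Primrec.fst.comp hu)))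
      (Primrec.snd.comp hu)

/-- The identity, except that `k + 1` is sent to `0` once the computation coded by `e` has
halted within the bound `k`. -/
def haltingCollision (e x : ℕ) : ℕ :=
  if (boundedEval e x.pred).isSome then 0 else x

theorem primrec₂_haltingCollision : Primrec₂ haltingCollision :=
  Primrec.ite
    (Primrec.eq.comp
      (Primrec.option_isSome.comp
        (primrec₂_boundedEval.comp Primrec.fst (Primrec.pred.comp Primrec.snd)))
      (Primrec.const true))
    (Primrec.const 0) Primrec.snd

theorem injective_haltingCollision_iff (c : Nat.Partrec.Code) (n : ℕ) :
    Function.Injective (haltingCollision (Nat.pair (Encodable.encode c) n)) ↔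
      ¬ (c.eval n).Dom := by
  have hb : ∀ k, boundedEval (Nat.pair (Encodable.encode c) n) k = c.evaln k n := by
    simp [boundedEval]
  constructor
  · intro hinj hdom
    obtain ⟨y, hy⟩ := Part.dom_iff_mem.1 hdom
    obtain ⟨k, hk⟩ := Nat.Partrec.Code.evaln_complete.1 hy
    have hk' : c.evaln k n = some y := hk
    have : k + 1 = 0 := hinj (by simp [haltingCollision, hb, hk'])
    omega
  · intro hdom
    have hnone : ∀ k, c.evaln k n = none := fun k =>
      Option.eq_none_iff_forall_not_mem.2 fun y hy =>
        hdom (Part.dom_iff_mem.2 ⟨y, Nat.Partrec.Code.evaln_sound hy⟩)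
    intro x y hxy
    simpa [haltingCollision, hb, hnone] using hxy

theorem injective_Pi1_complete :
    (∀ F : ℕ → ℕ → ℕ, Primrec₂ F → Pi1 fun n => Function.Injective (F n)) ∧
    (∃ F : ℕ → ℕ → ℕ, Primrec₂ F ∧
      Pi1Complete fun n => Function.Injective (F n)) := by
  refine ⟨fun F hF => pi1_injective hF, haltingCollision, primrec₂_haltingCollision,
    pi1_injective primrec₂_haltingCollision, fun P hP => ?_⟩
  obtain ⟨c, hc⟩ := REPred.exists_code hP
  refine ⟨fun n => Nat.pair (Encodable.encode c) n,
    (Primrec₂.natPair.comp (Primrec.const _) Primrec.id).to_comp, fun n => ?_⟩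
  exact (((injective_haltingCollision_iff c n).trans (not_congr (hc n))).trans not_not).symm
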